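/- Fix real parameters a > 0, Γ > 0, ε > 0, k > 0 with 4a²(1+εk) > k², and let t₀* = (1/(2Γ))·log(4a²(1+εk)/k²). Let q(t) = k²·(k² − 4a²(1+εk)e^(−2Γt)). Then for every t₁ > t₀*, every twice differentiable function U : [0,∞) → ℝ satisfying U''(t) + q(t)·U(t) = 0 for all t ≥ 0 is bounded on [t₁, ∞): there exists K > 0 with |U(t)| ≤ K for all t ≥ t₁. -/

import Mathlib

/-- Above the Benjamin–Feir threshold (`4a²(1+εk) > k²`), with transition time
`t₀* = (1/(2Γ)) log(4a²(1+εk)/k²)`, every real solution of equation (2de0)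
`U'' + q(t)U = 0` is bounded on `[t₁, ∞)` for every `t₁ > t₀*`. -/
theorem stmt_11 (a Γ ε k : ℝ) (ha : 0 < a) (hΓ : 0 < Γ) (hε : 0 < ε) (hk : 0 < k)
    (hBF : k ^ 2 < 4 * a ^ 2 * (1 + ε * k))
    (t₀ : ℝ) (ht₀ : t₀ = 1 / (2 * Γ) * Real.log (4 * a ^ 2 * (1 + ε * k) / k ^ 2))
    (q : ℝ → ℝ)
    (hq : ∀ t, q t = k ^ 2 * (k ^ 2 - 4 * a ^ 2 * (1 + ε * k) * Real.exp (-2 * Γ * t))) :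
    ∀ t₁ > t₀, ∀ U U' U'' : ℝ → ℝ,
      (∀ t ≥ (0 : ℝ), HasDerivWithinAt U (U' t) (Set.Ici 0) t) →
      (∀ t ≥ (0 : ℝ), HasDerivWithinAt U' (U'' t) (Set.Ici 0) t) →
      (∀ t ≥ (0 : ℝ), U'' t + q t * U t = 0) →
      ∃ K > (0 : ℝ), ∀ t ≥ t₁, |U t| ≤ K := by
  intro t₁ ht₁ U U' U'' hU hU' hode
  obtain ⟨C, hC⟩ : ∃ C, C = 4 * a ^ 2 * (1 + ε * k) := ⟨_, rfl⟩
  rw [← hC] at hBF ht₀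
  simp only [← hC] at hq
  have hk2 : 0 < k ^ 2 := by positivity
  have hCpos : 0 < C := hk2.trans hBF
  have hlog : 0 < Real.log (C / k ^ 2) := Real.log_pos ((one_lt_div hk2).2 hBF)
  have ht₀pos : 0 < t₀ := by rw [ht₀]; positivity
  have h2 : 2 * Γ * t₀ = Real.log (C / k ^ 2) := by rw [ht₀]; field_simp
  have hqpos : ∀ t, t₁ ≤ t → 0 < q t := by
    intro t ht
    have h3 : Real.log (C / k ^ 2) < 2 * Γ * t := by
      rw [← h2]
      exact mul_lt_mul_of_pos_left (lt_of_lt_of_le ht₁ ht) (by positivity)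
    have h4 := (Real.log_lt_iff_lt_exp (by positivity)).1 h3
    rw [div_lt_iff₀ hk2] at h4
    have h5 : Real.exp (2 * Γ * t) * Real.exp (-2 * Γ * t) = 1 := by
      rw [← Real.exp_add]; simp
    have h6 : C * Real.exp (-2 * Γ * t) < k ^ 2 := by
      calc C * Real.exp (-2 * Γ * t)
          < Real.exp (2 * Γ * t) * k ^ 2 * Real.exp (-2 * Γ * t) :=
            mul_lt_mul_of_pos_right h4 (Real.exp_pos _)
        _ = k ^ 2 * (Real.exp (2 * Γ * t) * Real.exp (-2 * Γ * t)) := by ring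
        _ = k ^ 2 := by rw [h5, mul_one]
    rw [hq]
    exact mul_pos hk2 (sub_pos.2 h6)
  have hqd : ∀ t, HasDerivAt q (k ^ 2 * (C * (Real.exp (-2 * Γ * t) * (2 * Γ)))) t := by
    intro t
    have e : q = fun t => k ^ 2 * (k ^ 2 - C * Real.exp (-2 * Γ * t)) := funext hq
    rw [e]
    have h := (((((hasDerivAt_id t).const_mul (-2 * Γ)).exp).const_mul C).const_sub
      (k ^ 2)).const_mul (k ^ 2)
    refine h.congr_deriv ?_
    simp only [id]
    ring
  have hE : ∀ t, t₁ ≤ t → HasDerivAt (fun t => U t ^ 2 + U' t ^ 2 / q t)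
      (-(U' t ^ 2 * (k ^ 2 * (C * (Real.exp (-2 * Γ * t) * (2 * Γ)))) / q t ^ 2)) t := by
    intro t ht
    have htpos : 0 < t := by linarith
    have hn : Set.Ici (0 : ℝ) ∈ nhds t := Ici_mem_nhds htpos
    have d1 := (hU t htpos.le).hasDerivAt hn
    have d2 := (hU' t htpos.le).hasDerivAt hn
    have hq0 := (hqpos t ht).ne'
    have hu : U'' t = -(q t * U t) := by linarith [hode t htpos.le]
    rw [hu] at d2
    have h := (d1.pow 2).add ((d2.pow 2).div (hqd t) hq0)
    refine h.congr_deriv ?_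
    simp only [Pi.pow_apply]
    field_simp
    ring
  have hanti : AntitoneOn (fun t => U t ^ 2 + U' t ^ 2 / q t) (Set.Ici t₁) := by
    apply antitoneOn_of_deriv_nonpos (convex_Ici t₁)
    · exact fun t ht => (hE t ht).continuousAt.continuousWithinAt
    · exact fun t ht => (hE t (interior_subset ht)).differentiableAt.differentiableWithinAt
    · intro t ht
      rw [(hE t (interior_subset ht)).deriv]
      have : 0 < Real.exp (-2 * Γ * t) := Real.exp_pos _
      exact neg_nonpos.2 (by positivity)
  refine ⟨Real.sqrt (U t₁ ^ 2 + U' t₁ ^ 2 / q t₁) + 1, by positivity, fun t ht => ?_⟩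
  have h := hanti Set.self_mem_Ici ht ht
  simp only at h
  have h7 : 0 ≤ U' t ^ 2 / q t := div_nonneg (sq_nonneg _) (hqpos t ht).le
  have h8 := Real.abs_le_sqrt (show U t ^ 2 ≤ U t₁ ^ 2 + U' t₁ ^ 2 / q t₁ by linarith)
  linarith
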